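/- arXiv:2212.06389 — 10 statements merged into one kernel-verified Lean document; each statement's English description precedes it below -/
import Mathlib

section
/- Let 0 < R₀ < R, β > 0, and σ̲ ∈ [0,1]. Suppose σ : ℝ → ℝ is twice continuously differentiable on [R₀, R] and satisfies the radial nutrient equation σ''(r) + σ'(r)/r − σ(r) = 0 for all r ∈ [R₀, R], together with the boundary conditions σ(R₀) = σ̲ and σ'(R) = β(1 − σ(R)). Then 0 ≤ σ(r) ≤ 1 for all r ∈ [R₀, R]. -/
open Set Filter Topology

lemma max_right_aux {a b : ℝ} (hab : a < b) {f : ℝ → ℝ} {d : ℝ}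
    (hd : HasDerivWithinAt f d (Icc a b) b) (hm : ∀ y ∈ Icc a b, f y ≤ f b) : 0 ≤ d := by
  have h1 : HasDerivWithinAt f d (Iio b) b :=
    (hd.mono Ico_subset_Icc_self).mono_of_mem_nhdsWithin (Ico_mem_nhdsLT hab)
  rw [hasDerivWithinAt_iff_tendsto_slope' (by simp)] at h1
  refine ge_of_tendsto h1 ?_
  filter_upwards [Ico_mem_nhdsLT hab] with y hy
  rw [slope_def_field]
  have := hm y ⟨hy.1, hy.2.le⟩
  exact div_nonneg_of_nonpos (by linarith) (by linarith [hy.2])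

lemma max_int_aux {a b x : ℝ} (hx : x ∈ Ioo a b) {f f' : ℝ → ℝ} {d : ℝ}
    (hf : ∀ r ∈ Icc a b, HasDerivWithinAt f (f' r) (Icc a b) r)
    (hd : HasDerivWithinAt f' d (Icc a b) x) (hm : ∀ y ∈ Icc a b, f y ≤ f x) :
    f' x = 0 ∧ d ≤ 0 := by
  have hA : ∀ r ∈ Ioo a b, HasDerivAt f (f' r) r := fun r hr =>
    (hf r (Ioo_subset_Icc_self hr)).hasDerivAt (Icc_mem_nhds hr.1 hr.2)
  have h0 : f' x = 0 := by
    refine IsLocalMax.hasDerivAt_eq_zero (f := f) ?_ (hA x hx)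
    filter_upwards [Icc_mem_nhds hx.1 hx.2] with y hy using hm y hy
  refine ⟨h0, ?_⟩
  by_contra! hpos
  have h2 : HasDerivWithinAt f' d (Ioi x) x :=
    (hd.hasDerivAt (Icc_mem_nhds hx.1 hx.2)).hasDerivWithinAt
  rw [hasDerivWithinAt_iff_tendsto_slope' (by simp)] at h2
  have h3 := h2.eventually (lt_mem_nhds hpos)
  obtain ⟨u, hu, hsub⟩ := (mem_nhdsGT_iff_exists_Ioo_subset' hx.2).1 h3
  have hu' : x < u := hu
  obtain ⟨y, hy1, hy2⟩ := exists_between (lt_min hu' hx.2)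
  have hyu := hy2.trans_le (min_le_left _ _)
  have hyb := hy2.trans_le (min_le_right _ _)
  obtain ⟨c, hc, hce⟩ := exists_hasDerivAt_eq_slope f f' hy1
    (fun r hr => (hA r ⟨hx.1.trans_le hr.1, hr.2.trans_lt hyb⟩).continuousAt.continuousWithinAt)
    (fun r hr => hA r ⟨hx.1.trans hr.1, hr.2.trans hyb⟩)
  have h4 : 0 < slope f' x c := hsub ⟨hc.1, hc.2.trans hyu⟩
  rw [slope_def_field, h0, sub_zero] at h4
  have h5 : 0 < f' c := by
    rcases div_pos_iff.1 h4 with h | h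
    · exact h.1
    · linarith [h.2, hc.1]
  have h6 : f y ≤ f x := hm y ⟨(hx.1.trans hy1).le, hyb.le⟩
  have h7 : (f y - f x) / (y - x) ≤ 0 :=
    div_nonpos_of_nonpos_of_nonneg (by linarith) (by linarith)
  linarith

/-- maximum-principle bound `0 ≤ σ ≤ 1` for the radial nutrient
equation with Dirichlet data `σ̲` at `R₀` and Robin data at `R`. -/
theorem nutrient_bounds
    (R₀ R β σb : ℝ) (hR₀ : 0 < R₀) (hRR : R₀ < R) (hβ : 0 < β)
    (hσb : σb ∈ Icc (0 : ℝ) 1)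
    (σ σ' σ'' : ℝ → ℝ)
    (hd1 : ∀ r ∈ Icc R₀ R, HasDerivWithinAt σ (σ' r) (Icc R₀ R) r)
    (hd2 : ∀ r ∈ Icc R₀ R, HasDerivWithinAt σ' (σ'' r) (Icc R₀ R) r)
    (hcont : ContinuousOn σ'' (Icc R₀ R))
    (hode : ∀ r ∈ Icc R₀ R, σ'' r + σ' r / r - σ r = 0)
    (hbc₀ : σ R₀ = σb)
    (hbcR : σ' R = β * (1 - σ R)) :
    ∀ r ∈ Icc R₀ R, 0 ≤ σ r ∧ σ r ≤ 1 := by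
  have hne : (Icc R₀ R).Nonempty := ⟨R₀, le_refl _, hRR.le⟩
  have hc : ContinuousOn σ (Icc R₀ R) := fun r hr => (hd1 r hr).continuousWithinAt
  have hRm : R ∈ Icc R₀ R := ⟨hRR.le, le_refl _⟩
  obtain ⟨x, hx, hxm⟩ := isCompact_Icc.exists_isMaxOn hne hc
  obtain ⟨z, hz, hzm⟩ := isCompact_Icc.exists_isMinOn hne hc
  have hxm' : ∀ y ∈ Icc R₀ R, σ y ≤ σ x := fun y hy => hxm hy
  have hzm' : ∀ y ∈ Icc R₀ R, σ z ≤ σ y := fun y hy => hzm hy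
  have hmax : σ x ≤ 1 := by
    by_contra! h
    rcases eq_or_lt_of_le hx.1 with h1 | h1
    · rw [← h1, hbc₀] at h
      linarith [hσb.2]
    rcases eq_or_lt_of_le hx.2 with h2 | h2
    · subst h2
      have := max_right_aux hRR (hd1 x hRm) hxm'
      nlinarith
    · obtain ⟨e1, e2⟩ := max_int_aux ⟨h1, h2⟩ hd1 (hd2 x hx) hxm'
      have := hode x hx
      rw [e1, zero_div] at this
      linarith
  have hmin : 0 ≤ σ z := by
    by_contra! h
    rcases eq_or_lt_of_le hz.1 with h1 | h1
    · rw [← h1, hbc₀] at h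
      linarith [hσb.1]
    rcases eq_or_lt_of_le hz.2 with h2 | h2
    · subst h2
      have := max_right_aux hRR (hd1 z hRm).fun_neg (fun y hy => neg_le_neg (hzm' y hy))
      nlinarith
    · obtain ⟨e1, e2⟩ := max_int_aux (f := fun r => -σ r) (f' := fun r => -σ' r) ⟨h1, h2⟩
        (fun r hr => (hd1 r hr).fun_neg) (hd2 z hz).fun_neg
        (fun y hy => neg_le_neg (hzm' y hy))
      have := hode z hz
      have e3 : σ' z = 0 := neg_eq_zero.1 e1
      rw [e3, zero_div] at this
      linarith
  exact fun r hr => ⟨hmin.trans (hzm' r hr), (hxm' r hr).trans hmax⟩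
end

section
/- Let 0 < R₀ < R and β > 0. Suppose E : ℝ → ℝ is twice continuously differentiable on [R₀, R], satisfies the radial nutrient equation E''(r) + E'(r)/r − E(r) = 0 for all r ∈ [R₀, R], and the boundary conditions E(R₀) = 1 and E'(R) = −β E(R). Then for all r ∈ [R₀, R] one has 0 ≤ E(r) ≤ 1 and E'(r) ≤ 0. -/
open Set

/-- the solution `E = E_β` of the radial nutrient equation with
`E(R₀) = 1` and `E'(R) = -β E(R)` satisfies `0 ≤ E ≤ 1` and `E' ≤ 0` on `[R₀, R]`. -/
theorem E_beta_bounds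
    (R₀ R β : ℝ) (hR₀ : 0 < R₀) (hRR : R₀ < R) (hβ : 0 < β)
    (E E' E'' : ℝ → ℝ)
    (hd1 : ∀ r ∈ Icc R₀ R, HasDerivWithinAt E (E' r) (Icc R₀ R) r)
    (hd2 : ∀ r ∈ Icc R₀ R, HasDerivWithinAt E' (E'' r) (Icc R₀ R) r)
    (hcont : ContinuousOn E'' (Icc R₀ R))
    (hode : ∀ r ∈ Icc R₀ R, E'' r + E' r / r - E r = 0)
    (hbc₀ : E R₀ = 1)
    (hbcR : E' R = -β * E R) :
    ∀ r ∈ Icc R₀ R, (0 ≤ E r ∧ E r ≤ 1) ∧ E' r ≤ 0 := by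
  have hpos : ∀ r ∈ Icc R₀ R, 0 < r := fun r hr => lt_of_lt_of_le hR₀ hr.1
  have hRm : R ∈ Icc R₀ R := ⟨hRR.le, le_rfl⟩
  have h0m : R₀ ∈ Icc R₀ R := ⟨le_rfl, hRR.le⟩
  have hmono : ∀ f f' : ℝ → ℝ, (∀ r ∈ Icc R₀ R, HasDerivWithinAt f (f' r) (Icc R₀ R) r) →
      (∀ r ∈ Icc R₀ R, 0 ≤ f' r) → MonotoneOn f (Icc R₀ R) := by
    intro f f' hf hf'
    refine monotoneOn_of_hasDerivWithinAt_nonneg (f' := f') (convex_Icc _ _)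
      (fun r hr => (hf r hr).continuousWithinAt) ?_ ?_
    · intro r hr
      exact (hf r (interior_subset hr)).mono interior_subset
    · intro r hr
      exact hf' r (interior_subset hr)
  have hP : ∀ r ∈ Icc R₀ R,
      HasDerivWithinAt (fun x => x * E' x) (r * E r) (Icc R₀ R) r := by
    intro r hr
    have h := (hasDerivWithinAt_id r (Icc R₀ R)).mul (hd2 r hr)
    refine h.congr_deriv ?_
    have h1 := hode r hr
    have h2 : E'' r = E r - E' r / r := by linarith
    have h3 := (hpos r hr).ne'
    simp only [id, h2]
    field_simp
    ring
  have hQ : ∀ r ∈ Icc R₀ R,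
      HasDerivWithinAt (fun x => x * E' x * E x) (r * E r * E r + r * E' r * E' r)
        (Icc R₀ R) r := fun r hr => (hP r hr).mul (hd1 r hr)
  have hQm := hmono _ _ hQ (fun r hr => by
    have := hpos r hr
    nlinarith [mul_nonneg this.le (mul_self_nonneg (E r)),
      mul_nonneg this.le (mul_self_nonneg (E' r))])
  have hEE : ∀ r ∈ Icc R₀ R, E' r * E r ≤ 0 := by
    intro r hr
    have h : r * E' r * E r ≤ R * E' R * E R := hQm hr hRm hr.2
    have h2 : R * E' R * E R ≤ 0 := by
      rw [hbcR]
      nlinarith [mul_nonneg (mul_pos (hpos R hRm) hβ).le (mul_self_nonneg (E R))]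
    by_contra hc
    push Not at hc
    nlinarith [mul_pos (hpos r hr) hc]
  have hS := hmono (fun x => -(E x * E x)) _ (fun r hr => ((hd1 r hr).mul (hd1 r hr)).neg)
    (fun r hr => by nlinarith [hEE r hr])
  have hE0 : ∀ r ∈ Icc R₀ R, 0 ≤ E r := by
    intro s hs
    by_contra hc
    push Not at hc
    have hcE : ContinuousOn E (Icc R₀ s) := fun r hr =>
      ((hd1 r ⟨hr.1, hr.2.trans hs.2⟩).continuousWithinAt).mono (Icc_subset_Icc_right hs.2)
    obtain ⟨t, ht, ht0⟩ := intermediate_value_Icc' hs.1 hcE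
      (show (0 : ℝ) ∈ Icc (E s) (E R₀) from ⟨hc.le, by rw [hbc₀]; norm_num⟩)
    have h : -(E t * E t) ≤ -(E s * E s) := hS ⟨ht.1, ht.2.trans hs.2⟩ hs ht.2
    rw [ht0] at h
    nlinarith
  have hPm := hmono _ _ hP (fun r hr => mul_nonneg (hpos r hr).le (hE0 r hr))
  intro r hr
  refine ⟨⟨hE0 r hr, ?_⟩, ?_⟩
  · have h : -(E R₀ * E R₀) ≤ -(E r * E r) := hS h0m hr hr.1
    rw [hbc₀] at h
    nlinarith
  · have h : r * E' r ≤ R * E' R := hPm hr hRm hr.2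
    have h2 : R * E' R ≤ 0 := by
      rw [hbcR]
      nlinarith [mul_nonneg (mul_pos (hpos R hRm) hβ).le (hE0 R hRm)]
    by_contra hc
    push Not at hc
    nlinarith [mul_pos (hpos r hr) hc]
end

section
/- Let 0 < R₀ < R and β > 0. Suppose F : ℝ → ℝ is twice continuously differentiable on [R₀, R], satisfies the radial nutrient equation F''(r) + F'(r)/r − F(r) = 0 for all r ∈ [R₀, R], and the boundary conditions F(R₀) = 0 and F'(R) = β(1 − F(R)). Then for all r ∈ [R₀, R] one has 0 ≤ F(r) ≤ 1 and F'(r) ≥ 0. -/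
open Set

/-- the solution `F = F_β` of the radial nutrient equation with
`F(R₀) = 0` and `F'(R) = β (1 - F(R))` satisfies `0 ≤ F ≤ 1` and `F' ≥ 0` on `[R₀, R]`. -/
theorem F_beta_bounds
    (R₀ R β : ℝ) (hR₀ : 0 < R₀) (hRR : R₀ < R) (hβ : 0 < β)
    (F F' F'' : ℝ → ℝ)
    (hd1 : ∀ r ∈ Icc R₀ R, HasDerivWithinAt F (F' r) (Icc R₀ R) r)
    (hd2 : ∀ r ∈ Icc R₀ R, HasDerivWithinAt F' (F'' r) (Icc R₀ R) r)
    (hcont : ContinuousOn F'' (Icc R₀ R))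
    (hode : ∀ r ∈ Icc R₀ R, F'' r + F' r / r - F r = 0)
    (hbc₀ : F R₀ = 0)
    (hbcR : F' R = β * (1 - F R)) :
    ∀ r ∈ Icc R₀ R, (0 ≤ F r ∧ F r ≤ 1) ∧ 0 ≤ F' r := by
  have key : ∀ G G' : ℝ → ℝ, (∀ r ∈ Icc R₀ R, HasDerivWithinAt G (G' r) (Icc R₀ R) r) →
      (∀ r ∈ Icc R₀ R, 0 ≤ G' r) → MonotoneOn G (Icc R₀ R) := by
    intro G G' h1 h2
    exact monotoneOn_of_hasDerivWithinAt_nonneg (convex_Icc _ _)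
      (fun r hr => (h1 r hr).continuousWithinAt)
      (fun r hr => (h1 r (interior_subset hr)).mono interior_subset)
      (fun r hr => h2 r (interior_subset hr))
  have hL : R₀ ∈ Icc R₀ R := ⟨le_rfl, hRR.le⟩
  have hRm : R ∈ Icc R₀ R := ⟨hRR.le, le_rfl⟩
  have hG : MonotoneOn (fun r => r * (F r * F' r)) (Icc R₀ R) := by
    refine key _ _ (fun r hr => (hasDerivWithinAt_id r _).mul ((hd1 r hr).mul (hd2 r hr))) ?_
    intro r hr
    have hr0 : 0 < r := hR₀.trans_le hr.1
    have h := hode r hr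
    have h' : F'' r = F r - F' r / r := by linarith
    have : r * (F' r / r) = F' r := by field_simp
    have e : 1 * (F r * F' r) + r * (F' r * F' r + F r * F'' r)
        = r * (F' r * F' r + F r * F r) := by
      rw [h']; linear_combination (-F r) * this
    simp only [id]
    refine le_of_le_of_eq ?_ e.symm
    exact mul_nonneg hr0.le (add_nonneg (mul_self_nonneg _) (mul_self_nonneg _))
  have hFF : ∀ r ∈ Icc R₀ R, 0 ≤ F r * F' r := by
    intro r hr
    have hr0 : 0 < r := hR₀.trans_le hr.1
    have h := hG hL hr hr.1
    simp only [hbc₀, zero_mul, mul_zero] at h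
    exact nonneg_of_mul_nonneg_right h hr0
  have hSq : MonotoneOn (fun r => F r * F r) (Icc R₀ R) := by
    refine key _ _ (fun r hr => (hd1 r hr).mul (hd1 r hr)) ?_
    intro r hr
    have := hFF r hr
    nlinarith
  have hFR := hFF R hRm
  rw [hbcR] at hFR
  have hFR' : 0 ≤ F R * (1 - F R) := by
    by_contra hc
    push Not at hc
    nlinarith
  have hR0 : 0 ≤ F R := by nlinarith [sq_nonneg (F R)]
  have hR1 : F R ≤ 1 := by nlinarith [sq_nonneg (1 - F R)]
  have hnn : ∀ r ∈ Icc R₀ R, 0 ≤ F r := by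
    intro s hs
    by_contra hc
    push Not at hc
    have hcF : ContinuousOn F (Icc s R) := fun r hr =>
      ((hd1 r ⟨hs.1.trans hr.1, hr.2⟩).continuousWithinAt).mono (Icc_subset_Icc_left hs.1)
    obtain ⟨t, ht, ht0⟩ := intermediate_value_Icc hs.2 hcF ⟨hc.le, hR0⟩
    have h := hSq hs ⟨hs.1.trans ht.1, ht.2⟩ ht.1
    simp only [ht0] at h
    nlinarith
  have hmono : MonotoneOn F (Icc R₀ R) := by
    intro a ha b hb hab
    exact abs_le_of_sq_le_sq' (by simpa [sq] using hSq ha hb hab) (hnn b hb) |>.2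
  intro r hr
  refine ⟨⟨hnn r hr, (hmono hr hRm hr.2).trans hR1⟩, ?_⟩
  rw [← (hd1 r hr).derivWithin (uniqueDiffOn_Icc hRR r hr)]
  exact hmono.derivWithin_nonneg
end

section
/- Let 0 < R₀ < R, β > 0, and σ̲ ∈ [0,1]. Suppose σ : ℝ → ℝ is twice continuously differentiable on [R₀, R], satisfies the radial nutrient equation σ''(r) + σ'(r)/r − σ(r) = 0 for all r ∈ [R₀, R], and the boundary conditions σ(R₀) = σ̲ and σ'(R) = β(1 − σ(R)). Then the function r ↦ r σ'(r) is nondecreasing on [R₀, R]; in particular R σ'(R) ≥ R₀ σ'(R₀), and consequently the apoptosis parameter A := (2/(R² − R₀²)) (R σ'(R) − R₀ σ'(R₀)) satisfies A ≥ 0. -/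
open Set

/-- for the stationary radial nutrient profile, `r ↦ r σ'(r)` is
nondecreasing on `[R₀, R]`; in particular `R σ'(R) ≥ R₀ σ'(R₀)`, and the
apoptosis parameter `A = (2/(R² - R₀²)) (R σ'(R) - R₀ σ'(R₀))` is nonnegative. -/
theorem apoptosis_nonneg
    (R₀ R β σb : ℝ) (hR₀ : 0 < R₀) (hRR : R₀ < R) (hβ : 0 < β)
    (hσb : σb ∈ Icc (0 : ℝ) 1)
    (σ σ' σ'' : ℝ → ℝ)
    (hd1 : ∀ r ∈ Icc R₀ R, HasDerivWithinAt σ (σ' r) (Icc R₀ R) r)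
    (hd2 : ∀ r ∈ Icc R₀ R, HasDerivWithinAt σ' (σ'' r) (Icc R₀ R) r)
    (hcont : ContinuousOn σ'' (Icc R₀ R))
    (hode : ∀ r ∈ Icc R₀ R, σ'' r + σ' r / r - σ r = 0)
    (hbc₀ : σ R₀ = σb)
    (hbcR : σ' R = β * (1 - σ R)) :
    MonotoneOn (fun r => r * σ' r) (Icc R₀ R) ∧
      R₀ * σ' R₀ ≤ R * σ' R ∧
      0 ≤ 2 / (R ^ 2 - R₀ ^ 2) * (R * σ' R - R₀ * σ' R₀) := by
  have hc1 : ContinuousOn σ (Icc R₀ R) := fun r hr => (hd1 r hr).continuousWithinAt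
  have hc2 : ContinuousOn σ' (Icc R₀ R) := fun r hr => (hd2 r hr).continuousWithinAt
  have hcp : ContinuousOn (fun r => r * σ' r) (Icc R₀ R) := continuousOn_id.mul hc2
  have hD1 : ∀ r ∈ Ioo R₀ R, HasDerivAt σ (σ' r) r := fun r hr =>
    (hd1 r (Ioo_subset_Icc_self hr)).hasDerivAt (Icc_mem_nhds hr.1 hr.2)
  have hDp : ∀ r ∈ Ioo R₀ R, HasDerivAt (fun r => r * σ' r) (r * σ r) r := by
    intro r hr
    have h2 := (hd2 r (Ioo_subset_Icc_self hr)).hasDerivAt (Icc_mem_nhds hr.1 hr.2)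
    have h := (hasDerivAt_id r).mul h2
    have ho := hode r (Ioo_subset_Icc_self hr)
    have hr0 : r ≠ 0 := (hR₀.trans hr.1).ne'
    have e : r * σ r = 1 * σ' r + id r * σ'' r := by
      have : σ r = σ'' r + σ' r / r := by linarith
      rw [this]
      simp only [id]
      field_simp
      ring
    rw [e]
    exact h
  have hpos : ∀ r ∈ Icc R₀ R, 0 ≤ σ r := by
    obtain ⟨m, hm, hmin⟩ := isCompact_Icc.exists_isMinOn (nonempty_Icc.2 hRR.le) hc1
    have hmin' : ∀ r ∈ Icc R₀ R, σ m ≤ σ r := fun r hr => hmin hr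
    by_contra! hcon
    obtain ⟨r, hr, hneg⟩ := hcon
    have hmneg : σ m < 0 := (hmin' r hr).trans_lt hneg
    have hm0 : R₀ < m := by
      rcases hm.1.lt_or_eq with h | h
      · exact h
      · rw [← h, hbc₀] at hmneg
        linarith [hσb.1]
    have hs : 0 ≤ σ' m := by
      rcases hm.2.lt_or_eq with h | h
      · have hl : IsLocalMin σ m := hmin.isLocalMin (Icc_mem_nhds hm0 h)
        exact (hl.hasDerivAt_eq_zero (hD1 m ⟨hm0, h⟩)).ge
      · rw [h] at hmneg ⊢
        rw [hbcR]
        exact mul_nonneg hβ.le (by linarith)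
    obtain ⟨ε, hε, hball⟩ := Metric.continuousOn_iff.1 hc1 m hm (-σ m) (by linarith)
    obtain ⟨a, ha1, ha2⟩ := exists_between (max_lt hm0 (show m - ε < m by linarith))
    have haR : R₀ < a := (le_max_left _ _).trans_lt ha1
    have haε : m - ε < a := (le_max_right _ _).trans_lt ha1
    have hsub : Icc a m ⊆ Icc R₀ R := Icc_subset_Icc haR.le hm.2
    have hsub' : Ioo a m ⊆ Ioo R₀ R := Ioo_subset_Ioo haR.le hm.2
    have hng : ∀ x ∈ Icc a m, σ x < 0 := by
      intro x hx
      have h := hball x (hsub hx) (by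
        rw [Real.dist_eq, abs_lt]
        constructor <;> linarith [hx.1, hx.2])
      rw [Real.dist_eq, abs_lt] at h
      linarith [h.2]
    have hanti : StrictAntiOn (fun r => r * σ' r) (Icc a m) := by
      apply strictAntiOn_of_deriv_neg (convex_Icc a m) (hcp.mono hsub)
      intro x hx
      rw [interior_Icc] at hx
      rw [(hDp x (hsub' hx)).deriv]
      exact mul_neg_of_pos_of_neg (hR₀.trans (hsub' hx).1) (hng x (Ioo_subset_Icc_self hx))
    have hmono : StrictMonoOn σ (Icc a m) := by
      apply strictMonoOn_of_deriv_pos (convex_Icc a m) (hc1.mono hsub)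
      intro x hx
      rw [interior_Icc] at hx
      rw [(hD1 x (hsub' hx)).deriv]
      have h1 : m * σ' m < x * σ' x :=
        hanti (Ioo_subset_Icc_self hx) (right_mem_Icc.2 ha2.le) hx.2
      have h2 : 0 ≤ m * σ' m := mul_nonneg (hR₀.trans hm0).le hs
      exact pos_of_mul_pos_right (h2.trans_lt h1) (hR₀.trans (hsub' hx).1).le
    have h1 := hmono (left_mem_Icc.2 ha2.le) (right_mem_Icc.2 ha2.le) ha2
    have h2 := hmin' a (hsub (left_mem_Icc.2 ha2.le))
    linarith
  have hM : MonotoneOn (fun r => r * σ' r) (Icc R₀ R) := by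
    apply monotoneOn_of_deriv_nonneg (convex_Icc R₀ R) hcp
    · intro x hx
      rw [interior_Icc] at hx
      exact (hDp x hx).differentiableAt.differentiableWithinAt
    · intro x hx
      rw [interior_Icc] at hx
      rw [(hDp x hx).deriv]
      exact mul_nonneg (hR₀.trans hx.1).le (hpos x (Ioo_subset_Icc_self hx))
  have hle : R₀ * σ' R₀ ≤ R * σ' R :=
    hM (left_mem_Icc.2 hRR.le) (right_mem_Icc.2 hRR.le) hRR.le
  refine ⟨hM, hle, mul_nonneg (div_nonneg (by norm_num) ?_) (by linarith)⟩
  nlinarith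
end

section
/- Let 0 < R₀ < R, β > 0, and let l ≥ 1 be an integer. If Q₁ and Q₂ are both twice continuously differentiable on [R₀, R], both satisfy the modal equation r² Q''(r) + r Q'(r) − (r² + l²) Q(r) = 0 for all r ∈ [R₀, R], and satisfy Q₁(R₀) = Q₂(R₀) and Q₁'(R) + β Q₁(R) = Q₂'(R) + β Q₂(R), then Q₁(r) = Q₂(r) for all r ∈ [R₀, R]. -/
open Set

/-- uniqueness for the modal equation
`r² Q'' + r Q' - (r² + l²) Q = 0` on `[R₀, R]` with Dirichlet data at `R₀`
and Robin data `Q'(R) + β Q(R)` at `R`. -/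
theorem modal_uniqueness
    (R₀ R β : ℝ) (hR₀ : 0 < R₀) (hRR : R₀ < R) (hβ : 0 < β)
    (l : ℕ) (hl : 1 ≤ l)
    (Q₁ Q₁' Q₁'' Q₂ Q₂' Q₂'' : ℝ → ℝ)
    (hd11 : ∀ r ∈ Icc R₀ R, HasDerivWithinAt Q₁ (Q₁' r) (Icc R₀ R) r)
    (hd12 : ∀ r ∈ Icc R₀ R, HasDerivWithinAt Q₁' (Q₁'' r) (Icc R₀ R) r)
    (hc1 : ContinuousOn Q₁'' (Icc R₀ R))
    (hd21 : ∀ r ∈ Icc R₀ R, HasDerivWithinAt Q₂ (Q₂' r) (Icc R₀ R) r)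
    (hd22 : ∀ r ∈ Icc R₀ R, HasDerivWithinAt Q₂' (Q₂'' r) (Icc R₀ R) r)
    (hc2 : ContinuousOn Q₂'' (Icc R₀ R))
    (hode1 : ∀ r ∈ Icc R₀ R,
      r ^ 2 * Q₁'' r + r * Q₁' r - (r ^ 2 + (l : ℝ) ^ 2) * Q₁ r = 0)
    (hode2 : ∀ r ∈ Icc R₀ R,
      r ^ 2 * Q₂'' r + r * Q₂' r - (r ^ 2 + (l : ℝ) ^ 2) * Q₂ r = 0)
    (hbc₀ : Q₁ R₀ = Q₂ R₀)
    (hbcR : Q₁' R + β * Q₁ R = Q₂' R + β * Q₂ R) :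
    ∀ r ∈ Icc R₀ R, Q₁ r = Q₂ r := by
  have hw1 : ∀ r ∈ Icc R₀ R, HasDerivWithinAt (fun x => Q₁ x - Q₂ x) (Q₁' r - Q₂' r) (Icc R₀ R) r :=
    fun r hr => (hd11 r hr).sub (hd21 r hr)
  have hw2 : ∀ r ∈ Icc R₀ R,
      HasDerivWithinAt (fun x => Q₁' x - Q₂' x) (Q₁'' r - Q₂'' r) (Icc R₀ R) r :=
    fun r hr => (hd12 r hr).sub (hd22 r hr)
  have hF : ∀ r ∈ Icc R₀ R, HasDerivWithinAt
      (fun x => x * ((Q₁ x - Q₂ x) * (Q₁' x - Q₂' x)))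
      (1 * ((Q₁ r - Q₂ r) * (Q₁' r - Q₂' r)) + r * ((Q₁' r - Q₂' r) * (Q₁' r - Q₂' r)
        + (Q₁ r - Q₂ r) * (Q₁'' r - Q₂'' r))) (Icc R₀ R) r :=
    fun r hr => (hasDerivWithinAt_id r _).mul ((hw1 r hr).mul (hw2 r hr))
  have hG : ∀ r ∈ Icc R₀ R, HasDerivWithinAt
      (fun x => (Q₁ x - Q₂ x) * (Q₁ x - Q₂ x))
      ((Q₁' r - Q₂' r) * (Q₁ r - Q₂ r) + (Q₁ r - Q₂ r) * (Q₁' r - Q₂' r)) (Icc R₀ R) r :=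
    fun r hr => (hw1 r hr).mul (hw1 r hr)
  have hmono : MonotoneOn (fun x => x * ((Q₁ x - Q₂ x) * (Q₁' x - Q₂' x))) (Icc R₀ R) := by
    refine monotoneOn_of_hasDerivWithinAt_nonneg (convex_Icc _ _)
      (fun r hr => (hF r hr).continuousWithinAt)
      (fun r hr => (hF r (interior_subset hr)).mono interior_subset) ?_
    intro r hr
    have hr' := interior_subset hr
    have hpos : 0 < r := lt_of_lt_of_le hR₀ hr'.1
    have h1 := hode1 r hr'
    have h2 := hode2 r hr'
    refine nonneg_of_mul_nonneg_right (a := r) ?_ hpos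
    have e : r * (1 * ((Q₁ r - Q₂ r) * (Q₁' r - Q₂' r)) + r * ((Q₁' r - Q₂' r) * (Q₁' r - Q₂' r)
        + (Q₁ r - Q₂ r) * (Q₁'' r - Q₂'' r)))
        = r ^ 2 * (Q₁' r - Q₂' r) ^ 2 + (r ^ 2 + (l : ℝ) ^ 2) * (Q₁ r - Q₂ r) ^ 2 := by
      linear_combination (Q₁ r - Q₂ r) * (h1 - h2)
    rw [e]
    positivity
  have hRpos : 0 < R := hR₀.trans hRR
  have hL : R₀ ∈ Icc R₀ R := left_mem_Icc.2 hRR.le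
  have hRm : R ∈ Icc R₀ R := right_mem_Icc.2 hRR.le
  have hanti : AntitoneOn (fun x => (Q₁ x - Q₂ x) * (Q₁ x - Q₂ x)) (Icc R₀ R) := by
    refine antitoneOn_of_hasDerivWithinAt_nonpos (convex_Icc _ _)
      (fun r hr => (hG r hr).continuousWithinAt)
      (fun r hr => (hG r (interior_subset hr)).mono interior_subset) ?_
    intro r hr
    have hr' := interior_subset hr
    have hpos : 0 < r := lt_of_lt_of_le hR₀ hr'.1
    have hm := hmono hr' hRm hr'.2
    simp only at hm
    have e : Q₁' R - Q₂' R = -(β * (Q₁ R - Q₂ R)) := by linear_combination hbcR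
    have hle : R * ((Q₁ R - Q₂ R) * (Q₁' R - Q₂' R)) ≤ 0 := by
      have : 0 ≤ R * β * (Q₁ R - Q₂ R) ^ 2 := by positivity
      rw [e]
      linarith
    have : (Q₁ r - Q₂ r) * (Q₁' r - Q₂' r) ≤ 0 := by
      by_contra! hc
      have := mul_pos hpos hc
      linarith
    linarith
  intro r hr
  have h := hanti hL hr hr.1
  simp only [hbc₀, sub_self, mul_zero] at h
  have h0 := mul_self_eq_zero.1 (le_antisymm h (mul_self_nonneg _))
  linarith
end

section
/- Let 0 < R₀ < R, β > 0, and let l ≥ 1 be an integer. Suppose G : ℝ → ℝ is twice continuously differentiable on [R₀, R], satisfies the modal equation r² G''(r) + r G'(r) − (r² + l²) G(r) = 0 for all r ∈ [R₀, R], and the boundary conditions G(R₀) = 0 and G'(R) + β G(R) = 1. Then G'(r) ≥ 0 for all r ∈ [R₀, R]. -/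
open Set

/-- the normalized modal solution `G = G_β(·; l)` with `G(R₀) = 0`
and `G'(R) + β G(R) = 1` has nonnegative derivative on `[R₀, R]`. -/
theorem G_beta_deriv_nonneg
    (R₀ R β : ℝ) (hR₀ : 0 < R₀) (hRR : R₀ < R) (hβ : 0 < β)
    (l : ℕ) (hl : 1 ≤ l)
    (G G' G'' : ℝ → ℝ)
    (hd1 : ∀ r ∈ Icc R₀ R, HasDerivWithinAt G (G' r) (Icc R₀ R) r)
    (hd2 : ∀ r ∈ Icc R₀ R, HasDerivWithinAt G' (G'' r) (Icc R₀ R) r)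
    (hcont : ContinuousOn G'' (Icc R₀ R))
    (hode : ∀ r ∈ Icc R₀ R,
      r ^ 2 * G'' r + r * G' r - (r ^ 2 + (l : ℝ) ^ 2) * G r = 0)
    (hbc₀ : G R₀ = 0)
    (hbcR : G' R + β * G R = 1) :
    ∀ r ∈ Icc R₀ R, 0 ≤ G' r := by
  have hpos : ∀ r ∈ Icc R₀ R, 0 < r := fun r hr => lt_of_lt_of_le hR₀ hr.1
  have hL : R₀ ∈ Icc R₀ R := ⟨le_rfl, hRR.le⟩
  have hRm : R ∈ Icc R₀ R := ⟨hRR.le, le_rfl⟩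
  have mono : ∀ f f' : ℝ → ℝ, (∀ r ∈ Icc R₀ R, HasDerivWithinAt f (f' r) (Icc R₀ R) r) →
      (∀ r ∈ Icc R₀ R, 0 ≤ f' r) → MonotoneOn f (Icc R₀ R) := by
    intro f f' h h0
    apply monotoneOn_of_hasDerivWithinAt_nonneg (f' := f') (convex_Icc R₀ R)
    · exact fun r hr => (h r hr).continuousWithinAt
    · exact fun r hr => (h r (interior_subset hr)).mono interior_subset
    · exact fun r hr => h0 r (interior_subset hr)
  have hGc : ContinuousOn G (Icc R₀ R) := fun r hr => (hd1 r hr).continuousWithinAt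
  have hp : ∀ r ∈ Icc R₀ R,
      HasDerivWithinAt (fun x => x * G' x) (1 * G' r + r * G'' r) (Icc R₀ R) r :=
    fun r hr => (hasDerivWithinAt_id r _).mul (hd2 r hr)
  have hp' : ∀ r ∈ Icc R₀ R, r * (1 * G' r + r * G'' r) = (r ^ 2 + (l : ℝ) ^ 2) * G r := by
    intro r hr
    linear_combination hode r hr
  -- the product `G * (r G')` is nondecreasing
  have hF : MonotoneOn (fun x => G x * (x * G' x)) (Icc R₀ R) := by
    apply mono _ (fun r => G' r * (r * G' r) + G r * (1 * G' r + r * G'' r))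
    · exact fun r hr => (hd1 r hr).mul (hp r hr)
    · intro r hr
      have h0 := hpos r hr
      have h1 : 0 ≤ r * (G r * (1 * G' r + r * G'' r)) := by
        have : r * (G r * (1 * G' r + r * G'' r)) = (r ^ 2 + (l : ℝ) ^ 2) * (G r) ^ 2 := by
          linear_combination G r * hp' r hr
        rw [this]; positivity
      have h2 := nonneg_of_mul_nonneg_right h1 h0
      have h3 : 0 ≤ r * (G' r) ^ 2 := by positivity
      nlinarith
  have hGG : ∀ r ∈ Icc R₀ R, 0 ≤ G r * G' r := by
    intro r hr
    have h := hF hL hr hr.1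
    simp only [hbc₀, zero_mul] at h
    have h1 : 0 ≤ r * (G r * G' r) := by linarith
    exact nonneg_of_mul_nonneg_right h1 (hpos r hr)
  have hsq : MonotoneOn (fun x => G x * G x) (Icc R₀ R) := by
    apply mono _ (fun r => G' r * G r + G r * G' r)
    · exact fun r hr => (hd1 r hr).mul (hd1 r hr)
    · intro r hr
      have := hGG r hr
      nlinarith
  have hGR : 0 ≤ G R := by
    by_contra! h
    have h1 := hGG R hRm
    have h2 : β * G R < 0 := mul_neg_of_pos_of_neg hβ h
    have h3 : G R * G' R < 0 := mul_neg_of_neg_of_pos h (by linarith)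
    linarith
  have hG : ∀ r ∈ Icc R₀ R, 0 ≤ G r := by
    intro c hc
    by_contra! h
    obtain ⟨d, hd, hd0⟩ := intermediate_value_Icc hc.2
      (hGc.mono (Icc_subset_Icc_left hc.1)) (show (0 : ℝ) ∈ Icc (G c) (G R) from ⟨h.le, hGR⟩)
    have h1 := hsq hc ⟨hc.1.trans hd.1, hd.2⟩ hd.1
    simp only [hd0] at h1
    nlinarith
  have hG0 : 0 ≤ G' R₀ := by
    have h := hasDerivWithinAt_iff_tendsto_slope.1 (hd1 R₀ hL)
    rw [Icc_sdiff_left] at h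
    have : (nhdsWithin R₀ (Ioc R₀ R)).NeBot := by
      rw [nhdsWithin_Ioc_eq_nhdsGT hRR]; infer_instance
    refine ge_of_tendsto h ?_
    filter_upwards [self_mem_nhdsWithin] with x hx
    rw [slope_def_field, hbc₀, sub_zero]
    exact div_nonneg (hG x ⟨hx.1.le, hx.2⟩) (sub_pos.2 hx.1).le
  have hpm : MonotoneOn (fun x => x * G' x) (Icc R₀ R) := by
    apply mono _ _ hp
    intro r hr
    have h1 : 0 ≤ r * (1 * G' r + r * G'' r) := by
      rw [hp' r hr]
      exact mul_nonneg (by positivity) (hG r hr)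
    exact nonneg_of_mul_nonneg_right h1 (hpos r hr)
  intro r hr
  have h := hpm hL hr hr.1
  exact nonneg_of_mul_nonneg_right ((mul_nonneg hR₀.le hG0).trans h) (hpos r hr)
end

section
/- Let 0 < R₀ < R, β > 0, and let l ≥ 1 be an integer. Suppose G : ℝ → ℝ is twice continuously differentiable on [R₀, R], satisfies the modal equation r² G''(r) + r G'(r) − (r² + l²) G(r) = 0 for all r ∈ [R₀, R], and the boundary conditions G(R₀) = 0 and G'(R) + β G(R) = 1. Then 0 ≤ G(r) ≤ (1/β) (r/R)^l for all r ∈ [R₀, R]; in particular 0 ≤ G(r) ≤ 1/β on [R₀, R]. -/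
open Set

open Set Filter Topology in
theorem max_principle_aux
    (R₀ R β : ℝ) (hR₀ : 0 < R₀) (hRR : R₀ < R) (hβ : 0 < β) (l : ℝ)
    (u u' u'' : ℝ → ℝ)
    (hd1 : ∀ r ∈ Icc R₀ R, HasDerivWithinAt u (u' r) (Icc R₀ R) r)
    (hd2 : ∀ r ∈ Icc R₀ R, HasDerivWithinAt u' (u'' r) (Icc R₀ R) r)
    (hode : ∀ r ∈ Icc R₀ R, 0 ≤ r ^ 2 * u'' r + r * u' r - (r ^ 2 + l ^ 2) * u r)
    (h0 : u R₀ ≤ 0) (hR : u' R + β * u R ≤ 0) :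
    ∀ r ∈ Icc R₀ R, u r ≤ 0 := by
  have hc : ContinuousOn u (Icc R₀ R) := fun r hr => (hd1 r hr).continuousWithinAt
  obtain ⟨x, hx, hmax⟩ := isCompact_Icc.exists_isMaxOn (nonempty_Icc.2 hRR.le) hc
  intro r hr
  refine (hmax hr).trans ?_
  by_contra hpos
  push Not at hpos
  have hx0 : R₀ < x := by
    rcases hx.1.lt_or_eq with h | h
    · exact h
    · rw [← h] at hpos; linarith
  rcases hx.2.lt_or_eq with hxR | hxR
  · have hint : Icc R₀ R ∈ 𝓝 x := Icc_mem_nhds hx0 hxR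
    have hu0 : u' x = 0 :=
      (hmax.isLocalMax hint).hasDerivAt_eq_zero ((hd1 x hx).hasDerivAt hint)
    have hu2 : 0 < u'' x := by
      have h := hode x hx
      rw [hu0] at h
      have h3 : 0 < (x ^ 2 + l ^ 2) * u x := by
        have : 0 < x := hR₀.trans hx0
        positivity
      by_contra hneg
      push Not at hneg
      nlinarith [sq_nonneg x]
    have hs := (hasDerivAt_iff_tendsto_slope.1 ((hd2 x hx).hasDerivAt hint))
    have hev : ∀ᶠ y in 𝓝[>] x, 0 < slope u' x y :=
      (hs.mono_left (nhdsWithin_mono x (fun y hy => ne_of_gt hy))).eventually (lt_mem_nhds hu2)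
    obtain ⟨b, hb, hsub⟩ := (mem_nhdsGT_iff_exists_Ioo_subset).1 hev
    have hb' : x < b := hb
    obtain ⟨y, hy1, hy2⟩ := exists_between (lt_min hb' hxR)
    have hyb := hy2.trans_le (min_le_left _ _)
    have hyR := hy2.trans_le (min_le_right _ _)
    obtain ⟨z, hz, hz2⟩ := exists_hasDerivAt_eq_slope u u' hy1
      (hc.mono (Icc_subset_Icc hx0.le hyR.le))
      (fun w hw => (hd1 w ⟨(hx0.trans hw.1).le, (hw.2.trans hyR).le⟩).hasDerivAt
        (Icc_mem_nhds (hx0.trans hw.1) (hw.2.trans hyR)))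
    have hzs : 0 < slope u' x z := hsub ⟨hz.1, hz.2.trans hyb⟩
    rw [slope_def_field, hu0, sub_zero] at hzs
    have hz3 : 0 < u' z := by
      have := mul_pos hzs (sub_pos.2 hz.1)
      rwa [div_mul_cancel₀ _ (sub_pos.2 hz.1).ne'] at this
    rw [hz2] at hz3
    have := mul_pos hz3 (sub_pos.2 hy1)
    rw [div_mul_cancel₀ _ (sub_pos.2 hy1).ne'] at this
    have hm : u y ≤ u x := hmax ⟨(hx0.trans hy1).le, hyR.le⟩
    linarith
  · subst hxR
    have hlt : u' x < 0 := by nlinarith [mul_pos hβ hpos]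
    have hs := hasDerivWithinAt_iff_tendsto_slope.1 (hd1 x hx)
    have hle : 𝓝[<] x ≤ 𝓝[Icc R₀ x \ {x}] x := by
      rw [← nhdsWithin_Ioo_eq_nhdsLT hx0]
      exact nhdsWithin_mono x (fun y hy => ⟨⟨hy.1.le, hy.2.le⟩, ne_of_lt hy.2⟩)
    have hev : ∀ᶠ y in 𝓝[<] x, slope u x y < 0 :=
      (hs.mono_left hle).eventually (gt_mem_nhds hlt)
    have hev2 : ∀ᶠ y in 𝓝[<] x, y ∈ Ioo R₀ x := Ioo_mem_nhdsLT hx0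
    obtain ⟨y, hy, hy2⟩ := (hev.and hev2).exists
    have hm : u y ≤ u x := hmax ⟨hy2.1.le, hy2.2.le⟩
    rw [slope_def_field] at hy
    have : 0 ≤ (u y - u x) / (y - x) :=
      div_nonneg_of_nonpos (by linarith) (by linarith [hy2.2])
    linarith

/-- the normalized modal solution `G = G_β(·; l)` with `G(R₀) = 0`
and `G'(R) + β G(R) = 1` satisfies `0 ≤ G(r) ≤ (1/β)(r/R)^l`; in particular
`0 ≤ G(r) ≤ 1/β` on `[R₀, R]`. -/
theorem G_beta_bounds
    (R₀ R β : ℝ) (hR₀ : 0 < R₀) (hRR : R₀ < R) (hβ : 0 < β)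
    (l : ℕ) (hl : 1 ≤ l)
    (G G' G'' : ℝ → ℝ)
    (hd1 : ∀ r ∈ Icc R₀ R, HasDerivWithinAt G (G' r) (Icc R₀ R) r)
    (hd2 : ∀ r ∈ Icc R₀ R, HasDerivWithinAt G' (G'' r) (Icc R₀ R) r)
    (hcont : ContinuousOn G'' (Icc R₀ R))
    (hode : ∀ r ∈ Icc R₀ R,
      r ^ 2 * G'' r + r * G' r - (r ^ 2 + (l : ℝ) ^ 2) * G r = 0)
    (hbc₀ : G R₀ = 0)
    (hbcR : G' R + β * G R = 1) :
    ∀ r ∈ Icc R₀ R, (0 ≤ G r ∧ G r ≤ (1 / β) * (r / R) ^ l) ∧ G r ≤ 1 / β := by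
  have hRpos : 0 < R := hR₀.trans hRR
  have hlow := max_principle_aux R₀ R β hR₀ hRR hβ l (fun r => - G r) (fun r => - G' r)
    (fun r => - G'' r) (fun r hr => (hd1 r hr).fun_neg) (fun r hr => (hd2 r hr).fun_neg)
    (fun r hr => by have := hode r hr; linarith) (by simp [hbc₀])
    (by linarith)
  obtain ⟨n, rfl⟩ : ∃ n, l = n + 1 := ⟨l - 1, by omega⟩
  obtain ⟨c, hcdef⟩ : ∃ c : ℝ, c = 1 / (β * R ^ (n + 1)) := ⟨_, rfl⟩
  have hc : 0 < c := by rw [hcdef]; positivity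
  have hcR : β * (c * R ^ (n + 1)) = 1 := by rw [hcdef]; field_simp
  have hup := max_principle_aux R₀ R β hR₀ hRR hβ ((n + 1 : ℕ) : ℝ)
    (fun r => G r - c * r ^ (n + 1)) (fun r => G' r - c * (((n + 1 : ℕ) : ℝ) * r ^ n))
    (fun r => G'' r - c * (((n + 1 : ℕ) : ℝ) * ((n : ℝ) * r ^ (n - 1))))
    (fun r hr => (hd1 r hr).fun_sub
      (((hasDerivAt_pow (n + 1) r).const_mul c).hasDerivWithinAt))
    (fun r hr => (hd2 r hr).fun_sub
      ((((hasDerivAt_pow n r).const_mul _).const_mul c).hasDerivWithinAt))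
    (fun r hr => by
      have h := hode r hr
      have hr0 : 0 < r := hR₀.trans_le hr.1
      have hk : (n : ℝ) * r ^ (n - 1) * r = n * r ^ n := by
        cases n with
        | zero => simp
        | succ m => simp [pow_succ, mul_assoc]
      have hp : 0 ≤ r ^ 2 * (c * r ^ (n + 1)) := by positivity
      have e : r ^ 2 * (G'' r - c * (((n + 1 : ℕ) : ℝ) * ((n : ℝ) * r ^ (n - 1))))
          + r * (G' r - c * (((n + 1 : ℕ) : ℝ) * r ^ n))
          - (r ^ 2 + ((n + 1 : ℕ) : ℝ) ^ 2) * (G r - c * r ^ (n + 1))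
          = r ^ 2 * (c * r ^ (n + 1)) := by
        push_cast at h ⊢
        linear_combination h - r * c * (n + 1) * hk
      exact e ▸ hp)
    (by
      have : 0 < c * R₀ ^ (n + 1) := by positivity
      simp only [hbc₀]; linarith)
    (by
      have : 0 ≤ c * (((n + 1 : ℕ) : ℝ) * R ^ n) := by positivity
      simp only [mul_sub]; linarith)
  intro r hr
  have hr0 : 0 < r := hR₀.trans_le hr.1
  have h1 : G r ≤ (1 / β) * (r / R) ^ (n + 1) := by
    have h := hup r hr
    have e : (1 / β) * (r / R) ^ (n + 1) = c * r ^ (n + 1) := by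
      rw [hcdef, div_pow]; field_simp
    rw [e]; simpa using h
  refine ⟨⟨by simpa using hlow r hr, h1⟩, h1.trans ?_⟩
  have h2 : (r / R) ^ (n + 1) ≤ 1 :=
    pow_le_one₀ (by positivity) ((div_le_one hRpos).2 hr.2)
  exact mul_le_of_le_one_right (by positivity) h2
end

section
/- Let 0 < R₀ < R, β > 0, and let l ≥ 1 be an integer. Suppose G : ℝ → ℝ is twice continuously differentiable on [R₀, R], satisfies the modal equation r² G''(r) + r G'(r) − (r² + l²) G(r) = 0 for all r ∈ [R₀, R], and the boundary conditions G(R₀) = 0 and G'(R) + β G(R) = 1. Then for every r ∈ (R₀, R] one has G(r) > 0 and r G'(r) > l G(r), i.e. the quantity a_l(r) := G'(r)/G(r) − l/r is strictly positive on (R₀, R]. -/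
open Set

/-- for the normalized modal solution `G = G_β(·; l)`, one has
`G(r) > 0` and `r G'(r) > l G(r)` on `(R₀, R]`, i.e. the quantity
`a_l(r) = G'(r)/G(r) - l/r` is strictly positive there. -/
theorem a_l_pos
    (R₀ R β : ℝ) (hR₀ : 0 < R₀) (hRR : R₀ < R) (hβ : 0 < β)
    (l : ℕ) (hl : 1 ≤ l)
    (G G' G'' : ℝ → ℝ)
    (hd1 : ∀ r ∈ Icc R₀ R, HasDerivWithinAt G (G' r) (Icc R₀ R) r)
    (hd2 : ∀ r ∈ Icc R₀ R, HasDerivWithinAt G' (G'' r) (Icc R₀ R) r)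
    (hcont : ContinuousOn G'' (Icc R₀ R))
    (hode : ∀ r ∈ Icc R₀ R,
      r ^ 2 * G'' r + r * G' r - (r ^ 2 + (l : ℝ) ^ 2) * G r = 0)
    (hbc₀ : G R₀ = 0)
    (hbcR : G' R + β * G R = 1) :
    ∀ r ∈ Ioc R₀ R,
      0 < G r ∧ (l : ℝ) * G r < r * G' r ∧ 0 < G' r / G r - (l : ℝ) / r := by
  have hlt : ∀ r ∈ Icc R₀ R, 0 < r := fun r hr => lt_of_lt_of_le hR₀ hr.1
  have hint : ∀ r ∈ interior (Icc R₀ R), r ∈ Icc R₀ R := fun r hr => interior_subset hr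
  have hLm : R₀ ∈ Icc R₀ R := ⟨le_rfl, hRR.le⟩
  have hRm : R ∈ Icc R₀ R := ⟨hRR.le, le_rfl⟩
  have hcG : ContinuousOn G (Icc R₀ R) := fun r hr => (hd1 r hr).continuousWithinAt
  have hcG' : ContinuousOn G' (Icc R₀ R) := fun r hr => (hd2 r hr).continuousWithinAt
  -- derivative of `r G'`
  have hH : ∀ r ∈ Icc R₀ R,
      HasDerivWithinAt (fun x => x * G' x) ((r ^ 2 + (l : ℝ) ^ 2) * G r / r) (Icc R₀ R) r := by
    intro r hr
    have h := (hasDerivWithinAt_id r (Icc R₀ R)).mul (hd2 r hr)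
    refine h.congr_deriv ?_
    have := hlt r hr
    simp only [id]
    rw [eq_div_iff this.ne']
    linarith [hode r hr]
  -- `G * r G'` is monotone
  have hP : MonotoneOn (fun x => G x * (x * G' x)) (Icc R₀ R) := by
    refine monotoneOn_of_hasDerivWithinAt_nonneg (convex_Icc _ _)
      (hcG.mul (continuousOn_id.mul hcG'))
      (fun r hr => ((hd1 r (hint r hr)).mul (hH r (hint r hr))).mono interior_subset) ?_
    intro r hr
    have h0 := hlt r (hint r hr)
    have e : G' r * (r * G' r) + G r * ((r ^ 2 + (l : ℝ) ^ 2) * G r / r)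
      = r * G' r ^ 2 + (r ^ 2 + (l : ℝ) ^ 2) * G r ^ 2 / r := by ring
    rw [e]; positivity
  have hP0 : ∀ r ∈ Icc R₀ R, 0 ≤ G r * G' r := by
    intro r hr
    have h := hP hLm hr hr.1
    simp only [hbc₀, zero_mul] at h
    have h0 := hlt r hr
    have e : G r * (r * G' r) = r * (G r * G' r) := by ring
    rw [e] at h
    exact nonneg_of_mul_nonneg_right h h0
  have hS : MonotoneOn (fun x => G x * G x) (Icc R₀ R) := by
    refine monotoneOn_of_hasDerivWithinAt_nonneg (convex_Icc _ _) (hcG.mul hcG)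
      (fun r hr => ((hd1 r (hint r hr)).mul (hd1 r (hint r hr))).mono interior_subset) ?_
    intro r hr
    linarith [hP0 r (hint r hr)]
  -- uniqueness
  have hE : G' R₀ ≠ 0 := by
    intro h0
    set C : ℝ := (1 + R ^ 2 + (l : ℝ) ^ 2) / R₀ with hC
    have hA : AntitoneOn (fun x => (G x * G x + (x * G' x) * (x * G' x)) * Real.exp (-C * x))
        (Icc R₀ R) := by
      have hexp : ∀ r : ℝ, HasDerivAt (fun x => Real.exp (-C * x)) (Real.exp (-C * r) * (-C)) r := by
        intro r
        simpa using ((hasDerivAt_id r).const_mul (-C)).exp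
      refine antitoneOn_of_hasDerivWithinAt_nonpos (convex_Icc _ _) ?_
        (fun r hr => ((((hd1 r (hint r hr)).mul (hd1 r (hint r hr))).add
          ((hH r (hint r hr)).mul (hH r (hint r hr)))).mul
            (hexp r).hasDerivWithinAt).mono interior_subset) ?_
      · exact ((hcG.mul hcG).add ((continuousOn_id.mul hcG').mul (continuousOn_id.mul hcG'))).mul
          (by fun_prop)
      · intro r hr
        have hr' := hint r hr
        have hr0 := hlt r hr'
        simp only [Pi.add_apply, Pi.mul_apply]
        set H := r * G' r with hHdef
        have hg : G' r = H / r := by rw [hHdef]; field_simp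
        rw [hg]
        set K : ℝ := (1 + r ^ 2 + (l : ℝ) ^ 2) / r with hK
        have hKC : K ≤ C := by
          rw [hK, hC]
          have h1 := hr'.1
          have h2 := hr'.2
          gcongr
        have hK0 : 0 ≤ K := by positivity
        have e : (H / r * G r + G r * (H / r) + ((r ^ 2 + (l : ℝ) ^ 2) * G r / r * H
            + H * ((r ^ 2 + (l : ℝ) ^ 2) * G r / r))) * Real.exp (-C * r)
            + (G r * G r + H * H) * (Real.exp (-C * r) * (-C))
            = (K * (2 * G r * H) - C * (G r * G r + H * H)) * Real.exp (-C * r) := by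
          rw [hK]; ring
        rw [e]
        refine mul_nonpos_of_nonpos_of_nonneg ?_ (Real.exp_pos _).le
        have h1 : K * (2 * G r * H) ≤ K * (G r * G r + H * H) :=
          mul_le_mul_of_nonneg_left (by nlinarith [sq_nonneg (G r - H)]) hK0
        have h2 : K * (G r * G r + H * H) ≤ C * (G r * G r + H * H) :=
          mul_le_mul_of_nonneg_right hKC (by nlinarith [mul_self_nonneg (G r), mul_self_nonneg H])
        linarith
    have h := hA hLm hRm hRR.le
    simp only [hbc₀, h0, mul_zero, add_zero, zero_mul] at h
    have h1 : G R * G R + (R * G' R) * (R * G' R) ≤ 0 :=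
      nonpos_of_mul_nonpos_left h (Real.exp_pos _)
    have hg : G R = 0 := by
      have := mul_self_nonneg (R * G' R)
      exact mul_self_eq_zero.mp (le_antisymm (by linarith) (mul_self_nonneg _))
    have hg' : R * G' R = 0 := by
      have := mul_self_nonneg (G R)
      exact mul_self_eq_zero.mp (le_antisymm (by linarith) (mul_self_nonneg _))
    have hg'' : G' R = 0 := (mul_eq_zero.mp hg').resolve_left (hlt R hRm).ne'
    rw [hg, hg''] at hbcR
    norm_num at hbcR
  have hne : ∀ r ∈ Ioc R₀ R, G r ≠ 0 := by
    intro r hr h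
    apply hE
    have hsub : Icc R₀ r ⊆ Icc R₀ R := Icc_subset_Icc_right hr.2
    have hz : ∀ x ∈ Icc R₀ r, G x = 0 := by
      intro x hx
      have := hS (hsub hx) ⟨hr.1.le, hr.2⟩ hx.2
      simp only [h, mul_zero] at this
      exact mul_self_eq_zero.mp (le_antisymm this (mul_self_nonneg _))
    have hm : R₀ ∈ Icc R₀ r := ⟨le_rfl, hr.1.le⟩
    have h1 := (hd1 R₀ hLm).mono hsub
    have h2 : HasDerivWithinAt G 0 (Icc R₀ r) R₀ :=
      (hasDerivWithinAt_const R₀ (Icc R₀ r) (0 : ℝ)).congr hz (hz _ hm)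
    exact (uniqueDiffOn_Icc hr.1 R₀ hm).eq_deriv _ h1 h2
  have hGR : 0 < G R := by
    rcases lt_or_gt_of_ne (hne R ⟨hRR, le_rfl⟩) with h | h
    · exfalso
      have h1 := hP0 R hRm
      have h2 : 0 < G' R := by nlinarith
      nlinarith
    · exact h
  have hpos : ∀ r ∈ Ioc R₀ R, 0 < G r := by
    intro r hr
    by_contra hcon
    have hsub : Icc r R ⊆ Icc R₀ R := Icc_subset_Icc_left hr.1.le
    obtain ⟨x, hx, hx0⟩ := intermediate_value_Icc hr.2 (hcG.mono hsub)
      (show (0 : ℝ) ∈ Icc (G r) (G R) from ⟨not_lt.mp hcon, hGR.le⟩)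
    exact hne x ⟨lt_of_lt_of_le hr.1 hx.1, hx.2⟩ hx0
  have hG'0 : 0 ≤ G' R₀ := by
    have hcl : closure (Ioc R₀ R) = Icc R₀ R := closure_Ioc hRR.ne
    refine le_on_closure (f := fun _ => (0 : ℝ)) (g := G') (s := Ioc R₀ R) ?_ continuousOn_const
      (by rw [hcl]; exact hcG') (by rw [hcl]; exact hLm)
    intro x hx
    exact nonneg_of_mul_nonneg_right (hP0 x ⟨hx.1.le, hx.2⟩) (hpos x hx)
  have hW : StrictMonoOn (fun x => x ^ l * (x * G' x - l * G x)) (Icc R₀ R) := by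
    refine strictMonoOn_of_hasDerivWithinAt_pos (convex_Icc _ _) ?_
      (fun r hr => (((hasDerivAt_pow l r).hasDerivWithinAt).mul ((hH r (hint r hr)).sub
        ((hd1 r (hint r hr)).const_mul (l : ℝ)))).mono interior_subset) ?_
    · exact (continuousOn_pow l).mul ((continuousOn_id.mul hcG').sub (continuousOn_const.mul hcG))
    · intro r hr
      have h0 := hlt r (hint r hr)
      rw [interior_Icc] at hr
      have hg := hpos r ⟨hr.1, hr.2.le⟩
      obtain ⟨k, rfl⟩ : ∃ k, l = k + 1 := ⟨l - 1, by omega⟩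
      have e : (((k + 1 : ℕ) : ℝ) * r ^ (k + 1 - 1)) * (r * G' r - ((k + 1 : ℕ) : ℝ) * G r)
          + r ^ (k + 1) * ((r ^ 2 + ((k + 1 : ℕ) : ℝ) ^ 2) * G r / r - ((k + 1 : ℕ) : ℝ) * G' r)
          = r ^ (k + 2) * G r := by
        rw [Nat.add_sub_cancel]
        field_simp
        ring
      have e2 : 0 < r ^ (k + 2) * G r := by positivity
      rw [← e] at e2
      exact e2
  intro r hr
  have hg := hpos r hr
  have hr' : r ∈ Icc R₀ R := ⟨hr.1.le, hr.2⟩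
  have h0 := hlt r hr'
  have h := hW hLm hr' hr.1
  simp only [hbc₀, mul_zero, sub_zero] at h
  have h1 : 0 ≤ R₀ ^ l * (R₀ * G' R₀) := by positivity
  have h2 : 0 < r * G' r - l * G r :=
    pos_of_mul_pos_right (lt_of_le_of_lt h1 h) (by positivity)
  refine ⟨hg, by linarith, ?_⟩
  have e : G' r / G r - (l : ℝ) / r = (r * G' r - l * G r) / (G r * r) := by
    field_simp
  rw [e]
  positivity
end

section
/- Let 0 < R₀ < R, β > 0, and let l ≥ 1 be an integer. Suppose G_l and G_{l+1} are twice continuously differentiable on [R₀, R], G_l satisfies r² G_l''(r) + r G_l'(r) − (r² + l²) G_l(r) = 0 and G_{l+1} satisfies r² G_{l+1}''(r) + r G_{l+1}'(r) − (r² + (l+1)²) G_{l+1}(r) = 0 for all r ∈ [R₀, R], and both satisfy G_l(R₀) = G_{l+1}(R₀) = 0 and G_l'(R) + β G_l(R) = G_{l+1}'(R) + β G_{l+1}(R) = 1. Then for every r ∈ (R₀, R] one has G_l'(r)/G_l(r) − l/r > G_{l+1}'(r)/G_{l+1}(r) − (l+1)/r; that is, the sequence a_l(r) = G_β'(r; l)/G_β(r;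 l) − l/r is strictly decreasing in l at each fixed r ∈ (R₀, R]. -/
open Set

lemma aux_mono {a b : ℝ} {f f' : ℝ → ℝ}
    (hf : ∀ r ∈ Icc a b, HasDerivWithinAt f (f' r) (Icc a b) r)
    (h0 : ∀ r ∈ Ioo a b, 0 ≤ f' r) : MonotoneOn f (Icc a b) := by
  refine monotoneOn_of_hasDerivWithinAt_nonneg (f' := f') (convex_Icc a b)
    (fun r hr => (hf r hr).continuousWithinAt) ?_ ?_
  · intro x hx
    exact (hf x (interior_subset hx)).mono interior_subset
  · intro x hx
    rw [interior_Icc] at hx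
    exact h0 x hx

lemma aux_smono {a b : ℝ} {f f' : ℝ → ℝ}
    (hf : ∀ r ∈ Icc a b, HasDerivWithinAt f (f' r) (Icc a b) r)
    (h0 : ∀ r ∈ Ioo a b, 0 < f' r) : StrictMonoOn f (Icc a b) := by
  refine strictMonoOn_of_hasDerivWithinAt_pos (f' := f') (convex_Icc a b)
    (fun r hr => (hf r hr).continuousWithinAt) ?_ ?_
  · intro x hx
    exact (hf x (interior_subset hx)).mono interior_subset
  · intro x hx
    rw [interior_Icc] at hx
    exact h0 x hx

lemma aux_pos (R₀ R β a : ℝ) (hR₀ : 0 < R₀) (hRR : R₀ < R) (hβ : 0 < β)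
    (G G' G'' : ℝ → ℝ)
    (hd1 : ∀ r ∈ Icc R₀ R, HasDerivWithinAt G (G' r) (Icc R₀ R) r)
    (hd2 : ∀ r ∈ Icc R₀ R, HasDerivWithinAt G' (G'' r) (Icc R₀ R) r)
    (hode : ∀ r ∈ Icc R₀ R, r ^ 2 * G'' r + r * G' r - (r ^ 2 + a ^ 2) * G r = 0)
    (hbc₀ : G R₀ = 0) (hbcR : G' R + β * G R = 1) :
    (∀ r ∈ Ioc R₀ R, 0 < G r) ∧ 0 ≤ G' R₀ := by
  have hL : R₀ ∈ Icc R₀ R := ⟨le_rfl, hRR.le⟩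
  have hRm : R ∈ Icc R₀ R := ⟨hRR.le, le_rfl⟩
  have hode' : ∀ r ∈ Icc R₀ R, G'' r = (1 + a ^ 2 / r ^ 2) * G r - G' r / r := by
    intro r hr
    have hr0 : 0 < r := hR₀.trans_le hr.1
    have := hode r hr
    field_simp
    linarith
  have hc : G' R₀ ≠ 0 := by
    intro hc
    set K : ℝ := 2 + a ^ 2 / R₀ ^ 2 with hK
    have hE : MonotoneOn (fun r => -((G r ^ 2 + G' r ^ 2) * Real.exp (-K * r))) (Icc R₀ R) := by
      apply aux_mono (f' := fun r => -((2 * G r * G' r + 2 * G' r * G'' r) * Real.exp (-K * r)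
        + (G r ^ 2 + G' r ^ 2) * (Real.exp (-K * r) * (-K))))
      · intro r hr
        have h1 := ((hd1 r hr).pow 2).add ((hd2 r hr).pow 2)
        have h2 : HasDerivWithinAt (fun r => Real.exp (-K * r)) (Real.exp (-K * r) * (-K))
            (Icc R₀ R) r := by
          have := ((hasDerivAt_id r).const_mul (-K)).exp.hasDerivWithinAt (s := Icc R₀ R)
          simpa using this
        refine HasDerivWithinAt.congr_deriv (h1.mul h2).neg ?_
        simp
      · intro r hr
        have hr' := Ioo_subset_Icc_self hr
        have hr0 : 0 < r := hR₀.trans hr.1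
        have hle : a ^ 2 / r ^ 2 ≤ a ^ 2 / R₀ ^ 2 := by
          have := hr.1.le
          gcongr
        have hq : 0 ≤ a ^ 2 / r ^ 2 := by positivity
        have key : 2 * G r * G' r + 2 * G' r * G'' r ≤ K * (G r ^ 2 + G' r ^ 2) := by
          rw [hode' r hr']
          have h1 : 0 ≤ G' r ^ 2 / r := by positivity
          have h2 : 2 * G' r * ((1 + a ^ 2 / r ^ 2) * G r - G' r / r)
            = (1 + a ^ 2 / r ^ 2) * (2 * G r * G' r) - 2 * (G' r ^ 2 / r) := by ring
          rw [h2]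
          have h3 : 2 * G r * G' r ≤ G r ^ 2 + G' r ^ 2 := by nlinarith [sq_nonneg (G r - G' r)]
          have h4 : (2 + a ^ 2 / r ^ 2) * (2 * G r * G' r)
            ≤ (2 + a ^ 2 / r ^ 2) * (G r ^ 2 + G' r ^ 2) := by gcongr
          have h5 : (2 + a ^ 2 / r ^ 2) * (G r ^ 2 + G' r ^ 2) ≤ K * (G r ^ 2 + G' r ^ 2) := by
            rw [hK]; gcongr
          linarith
        have he := Real.exp_pos (-K * r)
        nlinarith
    have := hE hL hRm hRR.le
    simp only [hbc₀, hc] at this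
    have he := Real.exp_pos (-K * R)
    have h0 : G R ^ 2 + G' R ^ 2 ≤ 0 := by
      by_contra hcon
      push Not at hcon
      have := mul_pos hcon he
      linarith
    have hG : G R = 0 := by nlinarith [sq_nonneg (G R), sq_nonneg (G' R)]
    have hG' : G' R = 0 := by nlinarith [sq_nonneg (G R), sq_nonneg (G' R)]
    rw [hG, hG'] at hbcR
    norm_num at hbcR
  have hP : MonotoneOn (fun r => r * (G r * G' r)) (Icc R₀ R) := by
    apply aux_mono (f' := fun r => 1 * (G r * G' r) + r * (G' r * G' r + G r * G'' r))
    · intro r hr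
      exact (hasDerivWithinAt_id r _).mul ((hd1 r hr).mul (hd2 r hr))
    · intro r hr
      have hr' := Ioo_subset_Icc_self hr
      have hr0 : 0 < r := hR₀.trans hr.1
      have : 1 * (G r * G' r) + r * (G' r * G' r + G r * G'' r)
        = r * G' r ^ 2 + r * (1 + a ^ 2 / r ^ 2) * G r ^ 2 := by
        rw [hode' r hr']; field_simp; ring
      simp only [this]
      positivity
  have hGG : ∀ r ∈ Icc R₀ R, 0 ≤ G r * G' r := by
    intro r hr
    have hr0 : 0 < r := hR₀.trans_le hr.1
    have := hP hL hr hr.1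
    simp only [hbc₀] at this
    by_contra hcon
    push Not at hcon
    have := mul_neg_of_pos_of_neg hr0 hcon
    linarith
  have hS : MonotoneOn (fun r => G r ^ 2) (Icc R₀ R) := by
    apply aux_mono (f' := fun r => 2 * (G r * G' r))
    · intro r hr
      refine HasDerivWithinAt.congr_deriv ((hd1 r hr).pow 2) ?_
      simp; ring
    · intro r hr
      have := hGG r (Ioo_subset_Icc_self hr)
      positivity
  have hne : ∀ r ∈ Ioc R₀ R, G r ≠ 0 := by
    intro s hs h0
    apply hc
    have hz : ∀ r ∈ Icc R₀ s, G r = 0 := by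
      intro r hr
      have := hS ⟨hr.1, hr.2.trans hs.2⟩ (Ioc_subset_Icc_self hs) hr.2
      simp only [h0] at this
      nlinarith [sq_nonneg (G r)]
    have hm : R₀ ∈ Icc R₀ s := ⟨le_rfl, hs.1.le⟩
    have h1 := (hd1 R₀ hL).mono (Icc_subset_Icc_right hs.2)
    have h2 : HasDerivWithinAt G 0 (Icc R₀ s) R₀ :=
      (hasDerivWithinAt_const R₀ (Icc R₀ s) (0:ℝ)).congr hz hbc₀
    exact ((uniqueDiffOn_Icc hs.1) R₀ hm).eq_deriv _ h1 h2
  have hGR : 0 < G R := by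
    by_contra hcon
    have h1 : G R < 0 := lt_of_le_of_ne (not_lt.1 hcon) (hne R ⟨hRR, le_rfl⟩)
    have h2 := hGG R hRm
    have h3 : G' R ≤ 0 := by
      by_contra h; push Not at h
      have := mul_neg_of_neg_of_pos h1 h
      linarith
    nlinarith
  have hpos : ∀ r ∈ Ioc R₀ R, 0 < G r := by
    intro r hr
    by_contra hcon
    have hcont : ContinuousOn G (Icc r R) := fun x hx =>
      ((hd1 x ⟨hr.1.le.trans hx.1, hx.2⟩).continuousWithinAt).mono (Icc_subset_Icc_left hr.1.le)
    obtain ⟨x, hx, hx0⟩ := intermediate_value_Icc hr.2 hcont ⟨not_lt.1 hcon, hGR.le⟩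
    exact hne x ⟨hr.1.trans_le hx.1, hx.2⟩ hx0
  refine ⟨hpos, ?_⟩
  have hG' : ∀ r ∈ Ioc R₀ R, 0 ≤ G' r := fun r hr =>
    nonneg_of_mul_nonneg_right (hGG r (Ioc_subset_Icc_self hr)) (hpos r hr)
  have hcw : ContinuousWithinAt G' (Ioc R₀ R) R₀ :=
    (hd2 R₀ hL).continuousWithinAt.mono Ioc_subset_Icc_self
  have hcl : R₀ ∈ closure (Ioc R₀ R) := by
    rw [closure_Ioc hRR.ne]; exact hL
  have := hcw.mem_closure hcl (t := Ici 0) (fun r hr => hG' r hr)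
  simpa using this

/-- the sequence `a_l(r) = G_β'(r; l)/G_β(r; l) - l/r` is strictly
decreasing in the mode `l` at each fixed `r ∈ (R₀, R]`. -/
theorem a_l_decreasing
    (R₀ R β : ℝ) (hR₀ : 0 < R₀) (hRR : R₀ < R) (hβ : 0 < β)
    (l : ℕ) (hl : 1 ≤ l)
    (Gl Gl' Gl'' Gm Gm' Gm'' : ℝ → ℝ)
    (hdl1 : ∀ r ∈ Icc R₀ R, HasDerivWithinAt Gl (Gl' r) (Icc R₀ R) r)
    (hdl2 : ∀ r ∈ Icc R₀ R, HasDerivWithinAt Gl' (Gl'' r) (Icc R₀ R) r)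
    (hcl : ContinuousOn Gl'' (Icc R₀ R))
    (hdm1 : ∀ r ∈ Icc R₀ R, HasDerivWithinAt Gm (Gm' r) (Icc R₀ R) r)
    (hdm2 : ∀ r ∈ Icc R₀ R, HasDerivWithinAt Gm' (Gm'' r) (Icc R₀ R) r)
    (hcm : ContinuousOn Gm'' (Icc R₀ R))
    (hodel : ∀ r ∈ Icc R₀ R,
      r ^ 2 * Gl'' r + r * Gl' r - (r ^ 2 + (l : ℝ) ^ 2) * Gl r = 0)
    (hodem : ∀ r ∈ Icc R₀ R,
      r ^ 2 * Gm'' r + r * Gm' r - (r ^ 2 + ((l : ℝ) + 1) ^ 2) * Gm r = 0)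
    (hbcl₀ : Gl R₀ = 0) (hbcm₀ : Gm R₀ = 0)
    (hbclR : Gl' R + β * Gl R = 1) (hbcmR : Gm' R + β * Gm R = 1) :
    ∀ r ∈ Ioc R₀ R,
      Gm' r / Gm r - ((l : ℝ) + 1) / r < Gl' r / Gl r - (l : ℝ) / r := by
  obtain ⟨hpl, hl0⟩ := aux_pos R₀ R β l hR₀ hRR hβ Gl Gl' Gl'' hdl1 hdl2 hodel hbcl₀ hbclR
  obtain ⟨hpm, -⟩ := aux_pos R₀ R β (l + 1) hR₀ hRR hβ Gm Gm' Gm'' hdm1 hdm2 hodem hbcm₀ hbcmR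
  have hL : R₀ ∈ Icc R₀ R := ⟨le_rfl, hRR.le⟩
  have hh : StrictMonoOn (fun r => r ^ l * (r * Gl' r - l * Gl r)) (Icc R₀ R) := by
    apply aux_smono (f' := fun r => (l * r ^ (l - 1) * 1) * (r * Gl' r - l * Gl r)
      + r ^ l * ((1 * Gl' r + r * Gl'' r) - l * Gl' r))
    · intro r hr
      exact ((hasDerivWithinAt_id r _).pow l).mul
        (((hasDerivWithinAt_id r _).mul (hdl2 r hr)).sub ((hdl1 r hr).const_mul _))
    · intro r hr
      have hr0 : 0 < r := hR₀.trans hr.1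
      have hg := hpl r (Ioo_subset_Ioc_self hr)
      have ho := hodel r (Ioo_subset_Icc_self hr)
      obtain ⟨k, rfl⟩ : ∃ k, l = k + 1 := ⟨l - 1, by omega⟩
      have : ((k + 1 : ℕ) * r ^ (k + 1 - 1) * 1) * (r * Gl' r - (k + 1 : ℕ) * Gl r)
          + r ^ (k + 1) * ((1 * Gl' r + r * Gl'' r) - (k + 1 : ℕ) * Gl' r)
          = r ^ k * (r ^ 2 * Gl r) := by
        simp only [Nat.add_sub_cancel]
        linear_combination r ^ k * ho
      simp only [this]
      positivity
  have hhpos : ∀ r ∈ Ioc R₀ R, 0 < r * Gl' r - l * Gl r := by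
    intro r hr
    have hr0 : 0 < r := hR₀.trans hr.1
    have := hh hL (Ioc_subset_Icc_self hr) hr.1
    simp only [hbcl₀] at this
    have h2 : 0 ≤ R₀ ^ l * (R₀ * Gl' R₀ - l * 0) := by
      rw [mul_zero, sub_zero]; positivity
    exact pos_of_mul_pos_right (h2.trans_lt this) (by positivity)
  have hW : StrictMonoOn (fun r => r * ((Gl r + r * Gl' r) * Gm r - r * Gl r * Gm' r))
      (Icc R₀ R) := by
    apply aux_smono (f' := fun r => 1 * ((Gl r + r * Gl' r) * Gm r - r * Gl r * Gm' r)
      + r * (((Gl' r + (1 * Gl' r + r * Gl'' r)) * Gm r + (Gl r + r * Gl' r) * Gm' r)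
        - ((1 * Gl r + r * Gl' r) * Gm' r + r * Gl r * Gm'' r)))
    · intro r hr
      have hi := hasDerivWithinAt_id r (Icc R₀ R)
      exact hi.mul ((((hdl1 r hr).add (hi.mul (hdl2 r hr))).mul (hdm1 r hr)).sub
        ((hi.mul (hdl1 r hr)).mul (hdm2 r hr)))
    · intro r hr
      have hr0 : 0 < r := hR₀.trans hr.1
      have ho1 := hodel r (Ioo_subset_Icc_self hr)
      have ho2 := hodem r (Ioo_subset_Icc_self hr)
      have h1 := hhpos r (Ioo_subset_Ioc_self hr)
      have h2 := hpm r (Ioo_subset_Ioc_self hr)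
      have : 1 * ((Gl r + r * Gl' r) * Gm r - r * Gl r * Gm' r)
          + r * (((Gl' r + (1 * Gl' r + r * Gl'' r)) * Gm r + (Gl r + r * Gl' r) * Gm' r)
          - ((1 * Gl r + r * Gl' r) * Gm' r + r * Gl r * Gm'' r))
          = 2 * Gm r * (r * Gl' r - l * Gl r) := by
        linear_combination Gm r * ho1 - Gl r * ho2
      simp only [this]
      positivity
  intro r hr
  have hr0 : 0 < r := hR₀.trans hr.1
  have h1 := hpl r hr
  have h2 := hpm r hr
  have h3 := hW hL (Ioc_subset_Icc_self hr) hr.1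
  simp only [hbcl₀, hbcm₀, mul_zero, zero_mul, sub_zero] at h3
  have h4 := pos_of_mul_pos_right h3 hr0.le
  have h5 : Gl' r / Gl r - (l : ℝ) / r - (Gm' r / Gm r - ((l : ℝ) + 1) / r)
      = ((Gl r + r * Gl' r) * Gm r - r * Gl r * Gm' r) / (r * Gl r * Gm r) := by
    field_simp
    ring
  have h6 : 0 < ((Gl r + r * Gl' r) * Gm r - r * Gl r * Gm' r) / (r * Gl r * Gm r) := by
    positivity
  linarith
end

section
/- Let 0 < R₀ < R, β > 0, and let l ≥ 1 be an integer. Suppose G_l and G_{l+1} are twice continuously differentiable on [R₀, R], G_l satisfies r² G_l''(r) + r G_l'(r) − (r² + l²) G_l(r) = 0 and G_{l+1} satisfies r² G_{l+1}''(r) + r G_{l+1}'(r) − (r² + (l+1)²) G_{l+1}(r) = 0 for all r ∈ [R₀, R], and both satisfy G_l(R₀) = G_{l+1}(R₀) = 0 and G_l'(R) + β G_l(R) = G_{l+1}'(R) + β G_{l+1}(R) = 1. Then G_{l+1}'(R₀) < G_l'(R₀) and G_l'(R) < G_{l+1}'(R); that is, b_l(R₀) = G_β'(R₀; l) is strictly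 decreasing in l while b_l(R) = G_β'(R; l) is strictly increasing in l. -/
open Set

theorem mono_aux {a b : ℝ} {f f' : ℝ → ℝ}
    (h : ∀ x ∈ Icc a b, HasDerivWithinAt f (f' x) (Icc a b) x)
    (h0 : ∀ x ∈ Icc a b, 0 ≤ f' x) : MonotoneOn f (Icc a b) :=
  monotoneOn_of_hasDerivWithinAt_nonneg (f' := f') (convex_Icc a b)
    (fun x hx => (h x hx).continuousWithinAt)
    (fun x hx => (h x (interior_subset hx)).mono interior_subset)
    (fun x hx => h0 x (interior_subset hx))

theorem deriv_left_nonneg {a b d : ℝ} {f : ℝ → ℝ} (hab : a < b)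
    (h : HasDerivWithinAt f d (Icc a b) a) (ha : f a = 0)
    (h0 : ∀ x ∈ Icc a b, 0 ≤ f x) : 0 ≤ d := by
  rw [hasDerivWithinAt_iff_tendsto_slope, Icc_sdiff_left] at h
  haveI : (nhdsWithin a (Ioc a b)).NeBot := by
    rw [nhdsWithin_Ioc_eq_nhdsGT hab]; infer_instance
  refine ge_of_tendsto h ?_
  filter_upwards [self_mem_nhdsWithin] with x hx
  rw [slope_def_field, ha, sub_zero]
  exact div_nonneg (h0 x ⟨hx.1.le, hx.2⟩) (by linarith [hx.1])

theorem deriv_zero_aux {a b x d : ℝ} {f : ℝ → ℝ} (hab : a < b) (hx : x ∈ Icc a b)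
    (h : HasDerivWithinAt f d (Icc a b) x)
    (h0 : ∀ y ∈ Icc a b, f y = 0) : d = 0 := by
  have h1 : HasDerivWithinAt f 0 (Icc a b) x :=
    (hasDerivWithinAt_const x (Icc a b) (0 : ℝ)).congr h0 (h0 x hx)
  exact (uniqueDiffOn_Icc hab x hx).eq_deriv _ h h1

/-- Uniqueness for the Cauchy problem with zero data. -/
theorem cauchy_zero {a b c : ℝ} (ha : 0 < a) (hab : a ≤ b) (hc : 0 ≤ c) {G G' G'' : ℝ → ℝ}
    (h1 : ∀ r ∈ Icc a b, HasDerivWithinAt G (G' r) (Icc a b) r)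
    (h2 : ∀ r ∈ Icc a b, HasDerivWithinAt G' (G'' r) (Icc a b) r)
    (ho : ∀ r ∈ Icc a b, r ^ 2 * G'' r + r * G' r - (r ^ 2 + c) * G r = 0)
    (hG : G a = 0) (hG' : G' a = 0) : G b = 0 := by
  set K : ℝ := (1 + b ^ 2 + c) / a with hK
  have hm := mono_aux (a := a) (b := b)
    (f := fun r => -(Real.exp (-(K * r)) * (G r ^ 2 + (r * G' r) ^ 2)))
    (f' := fun r => Real.exp (-(K * r)) *
      (K * (G r ^ 2 + (r * G' r) ^ 2) - 2 * (1 + r ^ 2 + c) * (G r * G' r))) ?_ ?_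
  · have := hm (left_mem_Icc.2 hab) (right_mem_Icc.2 hab) hab
    simp only [hG, hG'] at this
    have he := Real.exp_pos (-(K * b))
    have h3 : G b ^ 2 + (b * G' b) ^ 2 ≤ 0 := by
      by_contra hcon
      push Not at hcon
      have := mul_pos he hcon
      norm_num at *
      linarith
    have h4 : G b ^ 2 = 0 := by nlinarith [sq_nonneg (G b), sq_nonneg (b * G' b)]
    exact pow_eq_zero_iff (two_ne_zero) |>.1 h4
  · intro r hr
    have e1 : HasDerivWithinAt (fun r => Real.exp (-(K * r)))
        (Real.exp (-(K * r)) * (-(K * 1))) (Icc a b) r :=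
      (((hasDerivWithinAt_id r _).const_mul K).neg).exp
    have e2 := ((h1 r hr).pow 2).add ((((hasDerivWithinAt_id r _).mul (h2 r hr))).pow 2)
    refine ((e1.mul e2).neg).congr_deriv ?_
    have := ho r hr
    simp
    have h5 : r * (G' r + r * G'' r) = (r ^ 2 + c) * G r := by linarith
    linear_combination (-2 * Real.exp (-(K * r)) * G' r) * h5
  · intro r hr
    have hr0 : 0 < r := by linarith [hr.1]
    refine mul_nonneg (Real.exp_pos _).le ?_
    have k1 : 1 + r ^ 2 + c ≤ K * a := by
      rw [hK, div_mul_cancel₀ _ ha.ne']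
      nlinarith [hr.2]
    have hKp : 0 ≤ K := by rw [hK]; positivity
    have k2 : 1 + r ^ 2 + c ≤ K * r := k1.trans (mul_le_mul_of_nonneg_left hr.1 hKp)
    have k3 : 2 * (G r * (r * G' r)) ≤ G r ^ 2 + (r * G' r) ^ 2 := by
      nlinarith [sq_nonneg (G r - r * G' r)]
    by_cases hs : 0 ≤ G r * G' r
    · nlinarith [mul_le_mul_of_nonneg_right k2 hs, mul_le_mul_of_nonneg_left k3 hKp]
    · have : 0 ≤ K * (G r ^ 2 + (r * G' r) ^ 2) := by positivity
      have : 0 ≤ (1 + r ^ 2 + c) * (-(G r * G' r)) :=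
        mul_nonneg (by positivity) (by linarith)
      linarith

theorem pos_aux {R₀ R β c : ℝ} (hR₀ : 0 < R₀) (hRR : R₀ < R) (hβ : 0 < β) (hc : 0 ≤ c)
    {G G' G'' : ℝ → ℝ}
    (h1 : ∀ r ∈ Icc R₀ R, HasDerivWithinAt G (G' r) (Icc R₀ R) r)
    (h2 : ∀ r ∈ Icc R₀ R, HasDerivWithinAt G' (G'' r) (Icc R₀ R) r)
    (ho : ∀ r ∈ Icc R₀ R, r ^ 2 * G'' r + r * G' r - (r ^ 2 + c) * G r = 0)
    (hb₀ : G R₀ = 0) (hbR : G' R + β * G R = 1) :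
    (∀ r ∈ Ioc R₀ R, 0 < G r) ∧ 0 < G' R₀ := by
  have hl : R₀ ∈ Icc R₀ R := left_mem_Icc.2 hRR.le
  have hr : R ∈ Icc R₀ R := right_mem_Icc.2 hRR.le
  have hE := mono_aux (a := R₀) (b := R) (f := fun r => G r * (r * G' r))
    (f' := fun r => r * G' r ^ 2 + (r ^ 2 + c) / r * G r ^ 2) (by
      intro r hr
      have hr0 : 0 < r := by linarith [hr.1]
      refine ((h1 r hr).mul ((hasDerivWithinAt_id r _).mul (h2 r hr))).congr_deriv ?_
      have := ho r hr
      simp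
      field_simp
      linear_combination (G r) * this) (by
      intro r hr
      have hr0 : 0 < r := by linarith [hr.1]
      positivity)
  have hGG : ∀ r ∈ Icc R₀ R, 0 ≤ G r * G' r := by
    intro r hr
    have hr0 : 0 < r := by linarith [hr.1]
    have := hE hl hr hr.1
    simp only [hb₀, zero_mul] at this
    have h3 : 0 ≤ r * (G r * G' r) := by linarith
    exact nonneg_of_mul_nonneg_right h3 hr0
  have hS := mono_aux (a := R₀) (b := R) (f := fun r => G r ^ 2)
    (f' := fun r => 2 * (G r * G' r)) (by
      intro r hr
      refine ((h1 r hr).pow 2).congr_deriv ?_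
      simp
      ring) (fun r hr => by linarith [hGG r hr])
  have hzero : ∀ a ∈ Icc R₀ R, G a = 0 → ∀ r ∈ Icc R₀ a, G r = 0 := by
    intro a ha h0 r hr
    have := hS ⟨hr.1, hr.2.trans ha.2⟩ ha hr.2
    simp only [h0] at this
    nlinarith [sq_nonneg (G r)]
  have hRne : G R ≠ 0 := by
    intro h0
    have := deriv_zero_aux hRR hr (h1 R hr) (hzero R hr h0)
    rw [this, h0] at hbR
    norm_num at hbR
  have hRpos : 0 < G R := by
    by_contra hcon
    have hneg : G R < 0 := lt_of_le_of_ne (not_lt.1 hcon) hRne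
    have := hGG R hr
    have h3 : 0 < G' R := by nlinarith
    nlinarith
  have hsub : ∀ a ∈ Icc R₀ R, Icc a R ⊆ Icc R₀ R := fun a ha => Icc_subset_Icc_left ha.1
  have hC : ContinuousOn G (Icc R₀ R) := fun x hx => (h1 x hx).continuousWithinAt
  have hcz : ∀ a ∈ Icc R₀ R, G a = 0 → G' a ≠ 0 := by
    intro a ha h0 h0'
    exact hRne (cauchy_zero (by linarith [ha.1]) ha.2 hc
      (fun r hr => (h1 r (hsub a ha hr)).mono (hsub a ha))
      (fun r hr => (h2 r (hsub a ha hr)).mono (hsub a ha))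
      (fun r hr => ho r (hsub a ha hr)) h0 h0')
  have hne : ∀ a ∈ Ioc R₀ R, G a ≠ 0 := by
    intro a ha h0
    have ha' : a ∈ Icc R₀ R := ⟨ha.1.le, ha.2⟩
    refine hcz a ha' h0 (deriv_zero_aux ha.1 (right_mem_Icc.2 ha.1.le)
      ((h1 a ha').mono (Icc_subset_Icc_right ha.2)) (hzero a ha' h0))
  have hpos : ∀ a ∈ Ioc R₀ R, 0 < G a := by
    intro a ha
    by_contra hcon
    obtain ⟨y, hy, hy0⟩ := intermediate_value_Icc ha.2
      (hC.mono (hsub a ⟨ha.1.le, ha.2⟩)) ⟨not_lt.1 hcon, hRpos.le⟩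
    exact hne y ⟨ha.1.trans_le hy.1, hy.2⟩ hy0
  refine ⟨hpos, lt_of_le_of_ne ?_ (hcz R₀ hl hb₀).symm⟩
  refine deriv_left_nonneg hRR (h1 R₀ hl) hb₀ ?_
  intro x hx
  rcases hx.1.eq_or_lt with h | h
  · rw [← h, hb₀]
  · exact (hpos x ⟨h, hx.2⟩).le

/-- `b_l(R₀) = G_β'(R₀; l)` is strictly decreasing in `l` while
`b_l(R) = G_β'(R; l)` is strictly increasing in `l`. -/
theorem b_l_monotone
    (R₀ R β : ℝ) (hR₀ : 0 < R₀) (hRR : R₀ < R) (hβ : 0 < β)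
    (l : ℕ) (hl : 1 ≤ l)
    (Gl Gl' Gl'' Gm Gm' Gm'' : ℝ → ℝ)
    (hdl1 : ∀ r ∈ Icc R₀ R, HasDerivWithinAt Gl (Gl' r) (Icc R₀ R) r)
    (hdl2 : ∀ r ∈ Icc R₀ R, HasDerivWithinAt Gl' (Gl'' r) (Icc R₀ R) r)
    (hcl : ContinuousOn Gl'' (Icc R₀ R))
    (hdm1 : ∀ r ∈ Icc R₀ R, HasDerivWithinAt Gm (Gm' r) (Icc R₀ R) r)
    (hdm2 : ∀ r ∈ Icc R₀ R, HasDerivWithinAt Gm' (Gm'' r) (Icc R₀ R) r)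
    (hcm : ContinuousOn Gm'' (Icc R₀ R))
    (hodel : ∀ r ∈ Icc R₀ R,
      r ^ 2 * Gl'' r + r * Gl' r - (r ^ 2 + (l : ℝ) ^ 2) * Gl r = 0)
    (hodem : ∀ r ∈ Icc R₀ R,
      r ^ 2 * Gm'' r + r * Gm' r - (r ^ 2 + ((l : ℝ) + 1) ^ 2) * Gm r = 0)
    (hbcl₀ : Gl R₀ = 0) (hbcm₀ : Gm R₀ = 0)
    (hbclR : Gl' R + β * Gl R = 1) (hbcmR : Gm' R + β * Gm R = 1) :
    Gm' R₀ < Gl' R₀ ∧ Gl' R < Gm' R := by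

  have hl0 : R₀ ∈ Icc R₀ R := left_mem_Icc.2 hRR.le
  have hr0 : R ∈ Icc R₀ R := right_mem_Icc.2 hRR.le
  obtain ⟨pl, pl'⟩ := pos_aux hR₀ hRR hβ (sq_nonneg (l : ℝ)) hdl1 hdl2 hodel hbcl₀ hbclR
  obtain ⟨pm, pm'⟩ := pos_aux hR₀ hRR hβ (sq_nonneg ((l : ℝ) + 1)) hdm1 hdm2 hodem hbcm₀ hbcmR
  have hW' : ∀ r ∈ Icc R₀ R, HasDerivWithinAt
      (fun r => Gl r * (r * Gm' r) - Gm r * (r * Gl' r))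
      ((2 * (l : ℝ) + 1) / r * (Gl r * Gm r)) (Icc R₀ R) r := by
    intro r hr
    have hrp : 0 < r := by linarith [hr.1]
    have e := ((hdl1 r hr).mul ((hasDerivWithinAt_id r _).mul (hdm2 r hr))).sub
      ((hdm1 r hr).mul ((hasDerivWithinAt_id r _).mul (hdl2 r hr)))
    refine e.congr_deriv ?_
    have a1 := hodel r hr
    have a2 := hodem r hr
    simp
    field_simp
    linear_combination (Gl r) * a2 - (Gm r) * a1
  have hnn : ∀ r ∈ Icc R₀ R, 0 ≤ (2 * (l : ℝ) + 1) / r * (Gl r * Gm r) := by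
    intro r hr
    have hrp : 0 < r := by linarith [hr.1]
    rcases hr.1.eq_or_lt with h | h
    · rw [← h, hbcl₀]; simp
    · have := pl r ⟨h, hr.2⟩
      have := pm r ⟨h, hr.2⟩
      positivity
  have hW := mono_aux hW' hnn
  have hW0 : ∀ r ∈ Icc R₀ R, 0 ≤ Gl r * (r * Gm' r) - Gm r * (r * Gl' r) := by
    intro r hr
    have := hW hl0 hr hr.1
    simpa [hbcl₀, hbcm₀] using this
  have plR := pl R ⟨hRR, le_rfl⟩
  have pmR := pm R ⟨hRR, le_rfl⟩
  have hRp : 0 < R := hR₀.trans hRR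
  have hWR : 0 < Gl R * (R * Gm' R) - Gm R * (R * Gl' R) := by
    refine lt_of_le_of_ne (hW0 R hr0) (fun h => ?_)
    have := deriv_zero_aux hRR hr0 (hW' R hr0) (fun y hy =>
      le_antisymm ((hW hy hr0 hy.2).trans h.symm.le) (hW0 y hy))
    have hp : 0 < (2 * (l : ℝ) + 1) / R * (Gl R * Gm R) := by positivity
    linarith
  have hlt : Gm R < Gl R := by
    have e1 : Gl' R = 1 - β * Gl R := by linarith
    have e2 : Gm' R = 1 - β * Gm R := by linarith
    rw [e1, e2] at hWR
    have : 0 < R * (Gl R - Gm R) := by linarith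
    linarith [(pos_iff_pos_of_mul_pos this).1 hRp]
  refine ⟨?_, by nlinarith⟩
  have hQ : MonotoneOn (fun r => Gm r / Gl r) (Ioc R₀ R) := by
    have hd : ∀ x ∈ Ioc R₀ R, HasDerivWithinAt (fun r => Gm r / Gl r)
        ((Gm' x * Gl x - Gm x * Gl' x) / Gl x ^ 2) (Ioc R₀ R) x := by
      intro x hx
      exact ((hdm1 x ⟨hx.1.le, hx.2⟩).div (hdl1 x ⟨hx.1.le, hx.2⟩) (pl x hx).ne').mono
        Ioc_subset_Icc_self
    refine monotoneOn_of_hasDerivWithinAt_nonneg (convex_Ioc R₀ R)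
      (fun x hx => (hd x hx).continuousWithinAt)
      (fun x hx => (hd x (interior_subset hx)).mono interior_subset) (fun x hx => ?_)
    have hx' := interior_subset hx
    have hxp : 0 < x := by linarith [hx'.1]
    have h3 : 0 ≤ x * (Gm' x * Gl x - Gm x * Gl' x) := by
      linarith [hW0 x ⟨hx'.1.le, hx'.2⟩]
    exact div_nonneg (nonneg_of_mul_nonneg_right h3 hxp) (sq_nonneg _)
  have hc1 : Gm R / Gl R < 1 := (div_lt_one plR).2 hlt
  have hfin : 0 ≤ Gm R / Gl R * Gl' R₀ - Gm' R₀ := by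
    refine deriv_left_nonneg hRR (((hdl1 R₀ hl0).const_mul (Gm R / Gl R)).sub (hdm1 R₀ hl0))
      (by simp [hbcl₀, hbcm₀]) ?_
    intro x hx
    rcases hx.1.eq_or_lt with h | h
    · rw [← h]; simp [hbcl₀, hbcm₀]
    · have := hQ ⟨h, hx.2⟩ ⟨hRR, le_rfl⟩ hx.2
      have := (div_le_iff₀ (pl x ⟨h, hx.2⟩)).1 this
      simpa using this
  have := mul_lt_mul_of_pos_right hc1 pl'
  linarith
end
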